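/- For every positive integer n, there exists a bijection between the symmetric group S_n (the set of permutations of {1, …, n}) and the set of ordered pairs (P, Q) of standard Young tableaux with n entries such that P and Q have the same shape. -/

import Mathlib

/-- A standard Young tableau of shape `μ`, encoded as a function on cells
(`0` outside the diagram) which is a bijection from the cells of `μ` onto
`{1, …, μ.card}` and strictly increases along rows and along columns. -/
def IsSYT (μ : YoungDiagram) (T : ℕ × ℕ → ℕ) : Prop :=
  Set.BijOn T (μ.cells : Set (ℕ × ℕ)) (Set.Icc 1 μ.card) ∧
  (∀ i j1 j2 : ℕ, j1 < j2 → (i, j2) ∈ μ → T (i, j1) < T (i, j2)) ∧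
  (∀ i1 i2 j : ℕ, i1 < i2 → (i2, j) ∈ μ → T (i1, j) < T (i2, j)) ∧
  (∀ c : ℕ × ℕ, c ∉ μ → T c = 0)

/-- `f_μ`, the number of standard Young tableaux of shape `μ`. -/
noncomputable def sytCard (μ : YoungDiagram) : ℕ :=
  Nat.card {T : ℕ × ℕ → ℕ // IsSYT μ T}

namespace YoungDiagram

theorem finite_setOf_card_eq (n : ℕ) : {μ : YoungDiagram | μ.card = n}.Finite := by
  have hinj : Function.Injective YoungDiagram.cells := fun _ _ h => YoungDiagram.ext h
  refine Set.Finite.of_finite_image (f := YoungDiagram.cells) ?_ hinj.injOn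
  refine (Finset.range n ×ˢ Finset.range n).powerset.finite_toSet.subset ?_
  rintro _ ⟨μ, rfl, rfl⟩
  simp only [Finset.coe_powerset, Set.mem_preimage, Set.mem_powerset_iff, Finset.coe_subset]
  rintro ⟨i, j⟩ hc
  rw [mem_cells] at hc
  have hrow : μ.rowLen i ≤ μ.card := by
    rw [rowLen_eq_card]; exact Finset.card_le_card (Finset.filter_subset _ _)
  have hcol : μ.colLen j ≤ μ.card := by
    rw [colLen_eq_card]; exact Finset.card_le_card (Finset.filter_subset _ _)
  have hi := mem_iff_lt_colLen.1 hc
  have hj := mem_iff_lt_rowLen.1 hc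
  simp only [Finset.mem_product, Finset.mem_range]
  omega

/-- The finite set of Young diagrams with `n` cells. -/
noncomputable def ofCard (n : ℕ) : Finset YoungDiagram :=
  (finite_setOf_card_eq n).toFinset

@[simp] theorem mem_ofCard {n : ℕ} {μ : YoungDiagram} : μ ∈ ofCard n ↔ μ.card = n := by
  simp [ofCard]

theorem card_mono {μ ν : YoungDiagram} (h : μ ≤ ν) : μ.card ≤ ν.card :=
  Finset.card_le_card (cells_subset_iff.2 h)

theorem eq_of_le_of_card_le {μ ν : YoungDiagram} (h : μ ≤ ν) (hc : ν.card ≤ μ.card) : μ = ν :=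
  YoungDiagram.ext (Finset.eq_of_subset_of_card_le (cells_subset_iff.2 h) hc)

theorem card_sup_add_card_inf (μ ν : YoungDiagram) :
    (μ ⊔ ν).card + (μ ⊓ ν).card = μ.card + ν.card := by
  rw [YoungDiagram.card, YoungDiagram.card, cells_sup, cells_inf]
  exact Finset.card_union_add_card_inter _ _

theorem exists_cells_eq_insert {μ ν : YoungDiagram} (h : μ ≤ ν) (hc : ν.card = μ.card + 1) :
    ∃ c, c ∉ μ ∧ ν.cells = insert c μ.cells := by
  have hs := cells_subset_iff.2 h
  have h1 : (ν.cells \ μ.cells).card = 1 := by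
    rw [Finset.card_sdiff_of_subset hs]
    change ν.card - μ.card = 1
    omega
  obtain ⟨c, hc⟩ := Finset.card_eq_one.1 h1
  have hm : c ∈ ν.cells \ μ.cells := by simp [hc]
  refine ⟨c, by simpa using (Finset.mem_sdiff.1 hm).2, ?_⟩
  rw [Finset.insert_eq, ← hc, Finset.sdiff_union_of_subset hs]

open scoped Classical in
/-- The Young diagram with the given cells, or `⊥` if these do not form a lower set. -/
noncomputable def ofCells (s : Finset (ℕ × ℕ)) : YoungDiagram :=
  if h : IsLowerSet (s : Set (ℕ × ℕ)) then ⟨s, h⟩ else ⊥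

theorem cells_ofCells {s : Finset (ℕ × ℕ)} (h : IsLowerSet (s : Set (ℕ × ℕ))) :
    (ofCells s).cells = s := by
  simp [ofCells, h]

theorem isLowerSet_insert_rowLen {μ : YoungDiagram} {i : ℕ}
    (h : i = 0 ∨ μ.rowLen i < μ.rowLen (i - 1)) :
    IsLowerSet ((insert (i, μ.rowLen i) μ.cells : Finset (ℕ × ℕ)) : Set (ℕ × ℕ)) := by
  rintro ⟨a, b⟩ ⟨a', b'⟩ hle hmem
  obtain ⟨h1, h2⟩ := Prod.mk_le_mk.1 hle
  simp only [Finset.coe_insert, Set.mem_insert_iff, Finset.mem_coe, mem_cells,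
    Prod.mk.injEq] at hmem ⊢
  rcases hmem with ⟨rfl, rfl⟩ | hmem
  · rcases h1.lt_or_eq with h3 | rfl
    · right
      rw [mem_iff_lt_rowLen]
      have := μ.rowLen_anti a' (a - 1) (by omega)
      omega
    · rcases h2.lt_or_eq with h3 | rfl
      · right; rwa [mem_iff_lt_rowLen]
      · simp
  · exact Or.inr (μ.up_left_mem h1 h2 hmem)

theorem isLowerSet_erase_rowLen {μ : YoungDiagram} {i : ℕ}
    (h : μ.rowLen (i + 1) < μ.rowLen i) :
    IsLowerSet ((μ.cells.erase (i, μ.rowLen i - 1) : Finset (ℕ × ℕ)) : Set (ℕ × ℕ)) := by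
  rintro ⟨a, b⟩ ⟨a', b'⟩ hle hmem
  obtain ⟨h1, h2⟩ := Prod.mk_le_mk.1 hle
  simp only [Finset.coe_erase, Set.mem_sdiff, Set.mem_singleton_iff, Finset.mem_coe, mem_cells,
    Prod.mk.injEq] at hmem ⊢
  refine ⟨μ.up_left_mem h1 h2 hmem.1, ?_⟩
  rintro ⟨rfl, rfl⟩
  have h3 := mem_iff_lt_rowLen.1 hmem.1
  rcases h1.lt_or_eq with h4 | rfl
  · have := μ.rowLen_anti (a' + 1) a (by omega)
    omega
  · exact hmem.2 ⟨rfl, by omega⟩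

open scoped Classical in
theorem card_filter_le_eq_card_rows {n : ℕ} {μ : YoungDiagram} (hμ : μ.card = n) :
    ((ofCard (n + 1)).filter (μ ≤ ·)).card =
      ((Finset.range (n + 1)).filter fun i => i = 0 ∨ μ.rowLen i < μ.rowLen (i - 1)).card := by
  symm
  refine Finset.card_bij (fun i _ => ofCells (insert (i, μ.rowLen i) μ.cells)) ?_ ?_ ?_
  · intro i hi
    have h := cells_ofCells (isLowerSet_insert_rowLen (Finset.mem_filter.1 hi).2)
    rw [Finset.mem_filter, mem_ofCard, ← cells_subset_iff, YoungDiagram.card, h]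
    refine ⟨?_, Finset.subset_insert _ _⟩
    rw [Finset.card_insert_of_notMem (by simp [mem_iff_lt_rowLen]), ← hμ]
  · intro i hi k hk hik
    have h := cells_ofCells (isLowerSet_insert_rowLen (Finset.mem_filter.1 hi).2)
    have h' := cells_ofCells (isLowerSet_insert_rowLen (Finset.mem_filter.1 hk).2)
    have hm : (i, μ.rowLen i) ∈ insert (k, μ.rowLen k) μ.cells := by
      rw [← h', ← hik, h]; exact Finset.mem_insert_self _ _
    rcases Finset.mem_insert.1 hm with hm | hm
    · exact (Prod.mk.inj hm).1
    · simp [mem_iff_lt_rowLen] at hm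
  · intro ν hν
    rw [Finset.mem_filter, mem_ofCard] at hν
    obtain ⟨⟨i, j⟩, hc, hcells⟩ := exists_cells_eq_insert hν.2 (by omega)
    have hmem : ∀ a b, (a, b) ∈ ν ↔ (a = i ∧ b = j) ∨ (a, b) ∈ μ := by
      intro a b; rw [← mem_cells, hcells]; simp
    have hij : (i, j) ∈ ν := (hmem i j).2 (by simp)
    have hj : j = μ.rowLen i := by
      rw [mem_iff_lt_rowLen] at hc
      by_contra hne
      have h1 := (hmem i (j - 1)).1 (ν.up_left_mem le_rfl (by omega) hij)
      rw [mem_iff_lt_rowLen] at h1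
      omega
    have hrow : i = 0 ∨ μ.rowLen i < μ.rowLen (i - 1) := by
      by_cases hi : i = 0
      · exact Or.inl hi
      · have h1 := (hmem (i - 1) j).1 (ν.up_left_mem (by omega) le_rfl hij)
        rw [mem_iff_lt_rowLen] at h1
        omega
    refine ⟨i, ?_, ?_⟩
    · rw [Finset.mem_filter, Finset.mem_range]
      refine ⟨?_, hrow⟩
      have h1 : ν.colLen j ≤ ν.card := by
        rw [colLen_eq_card]; exact Finset.card_le_card (Finset.filter_subset _ _)
      have := mem_iff_lt_colLen.1 hij
      omega
    · apply YoungDiagram.ext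
      rw [cells_ofCells (isLowerSet_insert_rowLen hrow), hcells, hj]

open scoped Classical in
theorem card_filter_ge_eq_card_rows {n : ℕ} {μ : YoungDiagram} (hμ : μ.card = n + 1) :
    ((ofCard n).filter (· ≤ μ)).card =
      ((Finset.range (n + 1)).filter fun i => μ.rowLen (i + 1) < μ.rowLen i).card := by
  symm
  refine Finset.card_bij (fun i _ => ofCells (μ.cells.erase (i, μ.rowLen i - 1))) ?_ ?_ ?_
  · intro i hi
    have hr := (Finset.mem_filter.1 hi).2
    have h := cells_ofCells (isLowerSet_erase_rowLen hr)
    rw [Finset.mem_filter, mem_ofCard, ← cells_subset_iff, YoungDiagram.card, h]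
    refine ⟨?_, Finset.erase_subset _ _⟩
    rw [Finset.card_erase_of_mem (by rw [mem_cells, mem_iff_lt_rowLen]; omega)]
    change μ.card - 1 = n
    omega
  · intro i hi k hk hik
    have hr := (Finset.mem_filter.1 hi).2
    have h := cells_ofCells (isLowerSet_erase_rowLen hr)
    have h' := cells_ofCells (isLowerSet_erase_rowLen (Finset.mem_filter.1 hk).2)
    have hm : (i, μ.rowLen i - 1) ∉ μ.cells.erase (k, μ.rowLen k - 1) := by
      rw [← h', ← hik, h]; exact Finset.notMem_erase _ _
    by_contra hne
    refine hm (Finset.mem_erase.2 ⟨fun he => hne (Prod.mk.inj he).1, ?_⟩)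
    rw [mem_cells, mem_iff_lt_rowLen]
    omega
  · intro ν hν
    rw [Finset.mem_filter, mem_ofCard] at hν
    obtain ⟨⟨i, j⟩, hc, hcells⟩ := exists_cells_eq_insert hν.2 (by omega)
    have hmem : ∀ a b, (a, b) ∈ μ ↔ (a = i ∧ b = j) ∨ (a, b) ∈ ν := by
      intro a b; rw [← mem_cells, hcells]; simp
    have hij : (i, j) ∈ μ := (hmem i j).2 (by simp)
    have hj := mem_iff_lt_rowLen.1 hij
    have hout : ∀ a b, i ≤ a → j ≤ b → (a, b) ∈ μ → a = i ∧ b = j := fun a b ha hb h =>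
      ((hmem a b).1 h).resolve_right fun h' => hc (ν.up_left_mem ha hb h')
    have hj' : j = μ.rowLen i - 1 :=
      ((hout i (μ.rowLen i - 1) le_rfl (by omega)
        (by rw [mem_iff_lt_rowLen]; omega)).2).symm
    have hrow : μ.rowLen (i + 1) < μ.rowLen i := by
      by_contra hle
      have := (hout (i + 1) j (by omega) le_rfl (by rw [mem_iff_lt_rowLen]; omega)).1
      omega
    refine ⟨i, ?_, ?_⟩
    · rw [Finset.mem_filter, Finset.mem_range]
      refine ⟨?_, hrow⟩
      have h1 : μ.colLen j ≤ μ.card := by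
        rw [colLen_eq_card]; exact Finset.card_le_card (Finset.filter_subset _ _)
      have := mem_iff_lt_colLen.1 hij
      omega
    · apply YoungDiagram.ext
      rw [cells_ofCells (isLowerSet_erase_rowLen hrow), hcells, ← hj',
        Finset.erase_insert (by simpa using hc)]

open scoped Classical in
/-- A nonempty Young diagram has one more upper cover than lower covers. -/
theorem card_filter_le_eq_card_filter_ge_add_one {n : ℕ} {μ : YoungDiagram}
    (hμ : μ.card = n + 1) :
    ((ofCard (n + 2)).filter (μ ≤ ·)).card = ((ofCard n).filter (· ≤ μ)).card + 1 := by
  rw [card_filter_le_eq_card_rows hμ, card_filter_ge_eq_card_rows hμ, Finset.card_filter,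
    Finset.card_filter, Finset.sum_range_succ']
  simp

open scoped Classical in
/-- Distinct Young diagrams of the same size have as many common upper covers as common lower
covers. -/
theorem card_filter_le_le_eq_card_filter_ge_ge {n : ℕ} {μ κ : YoungDiagram}
    (hμ : μ.card = n + 1) (hκ : κ.card = n + 1) (hne : κ ≠ μ) :
    ((ofCard (n + 2)).filter fun ν => μ ≤ ν ∧ κ ≤ ν).card =
      ((ofCard n).filter fun ν => ν ≤ μ ∧ ν ≤ κ).card := by
  have hadd := card_sup_add_card_inf μ κ
  have hsup : n + 2 ≤ (μ ⊔ κ).card := by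
    by_contra h
    have h1 : μ = μ ⊔ κ := eq_of_le_of_card_le le_sup_left (by omega)
    have h2 : κ = μ ⊔ κ := eq_of_le_of_card_le le_sup_right (by omega)
    exact hne (h2.trans h1.symm)
  have hup : ((ofCard (n + 2)).filter fun ν => μ ≤ ν ∧ κ ≤ ν) =
      if (μ ⊔ κ).card = n + 2 then {μ ⊔ κ} else ∅ := by
    ext ν
    rw [Finset.mem_filter, mem_ofCard, ← sup_le_iff]
    split_ifs with h
    · rw [Finset.mem_singleton]
      refine ⟨fun hν => (eq_of_le_of_card_le hν.2 (by omega)).symm, ?_⟩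
      rintro rfl
      exact ⟨h, le_rfl⟩
    · simp only [Finset.notMem_empty, iff_false, not_and]
      intro h1 h2
      have := card_mono h2
      omega
  have hdown : ((ofCard n).filter fun ν => ν ≤ μ ∧ ν ≤ κ) =
      if (μ ⊔ κ).card = n + 2 then {μ ⊓ κ} else ∅ := by
    ext ν
    rw [Finset.mem_filter, mem_ofCard, ← le_inf_iff]
    split_ifs with h
    · rw [Finset.mem_singleton]
      refine ⟨fun hν => eq_of_le_of_card_le hν.2 (by omega), ?_⟩
      rintro rfl
      exact ⟨by omega, le_rfl⟩
    · simp only [Finset.notMem_empty, iff_false, not_and]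
      intro h1 h2
      have := card_mono h2
      omega
  rw [hup, hdown]
  split_ifs <;> simp

end YoungDiagram

open YoungDiagram

namespace IsSYT

variable {μ ν : YoungDiagram} {T : ℕ × ℕ → ℕ}

theorem mem_iff_ne_zero (hT : IsSYT μ T) (c : ℕ × ℕ) : c ∈ μ ↔ T c ≠ 0 := by
  refine ⟨fun h => ?_, fun h => by_contra fun h' => h (hT.2.2.2 c h')⟩
  have := (hT.1.mapsTo (Finset.mem_coe.2 ((mem_cells c).2 h))).1
  omega

theorem apply_le_card (hT : IsSYT μ T) (c : ℕ × ℕ) : T c ≤ μ.card := by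
  by_cases h : c ∈ μ
  · exact (hT.1.mapsTo (Finset.mem_coe.2 ((mem_cells c).2 h))).2
  · simp [hT.2.2.2 c h]

theorem apply_mono (hT : IsSYT μ T) {i i' j j' : ℕ} (hi : i ≤ i') (hj : j ≤ j')
    (h : (i', j') ∈ μ) : T (i, j) ≤ T (i', j') := by
  have h1 : T (i, j) ≤ T (i', j) := by
    rcases hi.lt_or_eq with hi | rfl
    · exact (hT.2.2.1 i i' j hi (μ.up_left_mem le_rfl hj h)).le
    · exact le_rfl
  have h2 : T (i', j) ≤ T (i', j') := by
    rcases hj.lt_or_eq with hj | rfl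
    · exact (hT.2.1 i' j j' hj h).le
    · exact le_rfl
  exact h1.trans h2

end IsSYT

theorem finite_setOf_isSYT (μ : YoungDiagram) : {T | IsSYT μ T}.Finite := by
  have hpi : (Set.univ.pi fun _ : μ.cells => Set.Iic μ.card).Finite :=
    Set.Finite.pi fun _ => Set.finite_Iic _
  refine Set.Finite.of_finite_image (f := fun T (c : μ.cells) => T c) (hpi.subset ?_) ?_
  · rintro _ ⟨T, hT, rfl⟩ c -
    exact hT.apply_le_card c
  · intro T hT T' hT' h
    funext c
    by_cases hc : c ∈ μ
    · exact congrFun h ⟨c, (mem_cells c).2 hc⟩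
    · rw [hT.2.2.2 c hc, hT'.2.2.2 c hc]

/-- The finite set of standard Young tableaux of shape `μ`. -/
noncomputable def sytFinset (μ : YoungDiagram) : Finset (ℕ × ℕ → ℕ) :=
  (finite_setOf_isSYT μ).toFinset

@[simp] theorem mem_sytFinset {μ : YoungDiagram} {T : ℕ × ℕ → ℕ} :
    T ∈ sytFinset μ ↔ IsSYT μ T := by
  simp [sytFinset]

theorem card_sytFinset (μ : YoungDiagram) : (sytFinset μ).card = sytCard μ :=
  (Nat.card_eq_card_finite_toFinset (finite_setOf_isSYT μ)).symm

/-- Extend a filling of `μ` to `ν` by giving all remaining cells of `ν` the entry `ν.card`. -/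
def extendTableau (ν μ : YoungDiagram) (T : ℕ × ℕ → ℕ) (c : ℕ × ℕ) : ℕ :=
  if c ∈ μ then T c else if c ∈ ν then ν.card else 0

theorem IsSYT.extend {μ ν : YoungDiagram} {T : ℕ × ℕ → ℕ} (hT : IsSYT μ T) (h : μ ≤ ν)
    (hc : ν.card = μ.card + 1) : IsSYT ν (extendTableau ν μ T) := by
  obtain ⟨d, hd, hcells⟩ := exists_cells_eq_insert h hc
  have hmem : ∀ c, c ∈ ν ↔ c = d ∨ c ∈ μ := by
    intro c; rw [← mem_cells, hcells]; simp
  have hin : ∀ c ∈ μ, extendTableau ν μ T c = T c := fun c hc => if_pos hc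
  have hlt : ∀ c ∈ μ, extendTableau ν μ T c < ν.card := by
    intro c hc'
    have := hT.apply_le_card c
    rw [hin c hc']; omega
  have hdv : extendTableau ν μ T d = ν.card := by
    rw [extendTableau, if_neg hd, if_pos ((hmem d).2 (Or.inl rfl))]
  refine ⟨?_, ?_, ?_, ?_⟩
  · have hI : Set.Icc 1 ν.card = insert ν.card (Set.Icc 1 μ.card) := by
      ext x; simp only [Set.mem_Icc, Set.mem_insert_iff]; omega
    have hb : Set.BijOn (extendTableau ν μ T) μ.cells (Set.Icc 1 μ.card) :=
      hT.1.congr fun c hc' => (hin c ((mem_cells c).1 (Finset.mem_coe.1 hc'))).symm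
    rw [hI, hcells, Finset.coe_insert]
    have := hb.insert (a := d) (by rw [hdv]; simp; omega)
    rwa [hdv] at this
  · intro i j1 j2 hj hm
    rcases (hmem _).1 hm with he | hm'
    · have h1 : (i, j1) ∈ μ := ((hmem _).1 (ν.up_left_mem le_rfl hj.le hm)).resolve_left (by
        rw [← he]; simp; omega)
      rw [he, hdv]; exact hlt _ h1
    · rw [hin _ hm', hin _ (μ.up_left_mem le_rfl hj.le hm')]
      exact hT.2.1 i j1 j2 hj hm'
  · intro i1 i2 j hi hm
    rcases (hmem _).1 hm with he | hm'
    · have h1 : (i1, j) ∈ μ := ((hmem _).1 (ν.up_left_mem hi.le le_rfl hm)).resolve_left (by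
        rw [← he]; simp; omega)
      rw [he, hdv]; exact hlt _ h1
    · rw [hin _ hm', hin _ (μ.up_left_mem hi.le le_rfl hm')]
      exact hT.2.2.1 i1 i2 j hi hm'
  · intro c hc'
    rw [extendTableau, if_neg fun h' => hc' (h h'), if_neg hc']

theorem IsSYT.mem_iff_extend_lt {μ ν : YoungDiagram} {T : ℕ × ℕ → ℕ} (hT : IsSYT μ T) (h : μ ≤ ν)
    (hc : ν.card = μ.card + 1) (c : ℕ × ℕ) :
    c ∈ μ ↔ c ∈ ν ∧ extendTableau ν μ T c < ν.card := by
  constructor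
  · intro h'
    have := hT.apply_le_card c
    exact ⟨h h', by rw [extendTableau, if_pos h']; omega⟩
  · rintro ⟨h1, h2⟩
    by_contra h'
    rw [extendTableau, if_neg h', if_pos h1] at h2
    exact lt_irrefl _ h2

/-- Removing the largest entry of a standard Young tableau. -/
theorem IsSYT.exists_eq_extend {ν : YoungDiagram} {T : ℕ × ℕ → ℕ} {n : ℕ} (hT : IsSYT ν T)
    (hν : ν.card = n + 1) :
    ∃ μ : YoungDiagram, μ.card = n ∧ μ ≤ ν ∧ ∃ T', IsSYT μ T' ∧ extendTableau ν μ T' = T := by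
  have hlow : IsLowerSet ((ν.cells.filter fun c => T c ≤ n : Finset (ℕ × ℕ)) : Set (ℕ × ℕ)) := by
    rintro ⟨a, b⟩ ⟨a', b'⟩ hle hm
    obtain ⟨h1, h2⟩ := Prod.mk_le_mk.1 hle
    simp only [Finset.coe_filter, mem_cells, Set.mem_ofPred_eq] at hm ⊢
    exact ⟨ν.up_left_mem h1 h2 hm.1, (hT.apply_mono h1 h2 hm.1).trans hm.2⟩
  let μ : YoungDiagram := ⟨_, hlow⟩
  have hmem : ∀ c, c ∈ μ ↔ c ∈ ν ∧ T c ≤ n := by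
    intro c; rw [← mem_cells, Finset.mem_filter, mem_cells]
  have hle : μ ≤ ν := fun c h => ((hmem c).1 h).1
  have hbij : Set.BijOn T μ.cells (Set.Icc 1 n) := by
    refine ⟨?_, hT.1.injOn.mono (Finset.coe_subset.2 (cells_subset_iff.2 hle)), ?_⟩
    · intro c hc
      have h1 := (hmem c).1 ((mem_cells c).1 (Finset.mem_coe.1 hc))
      exact ⟨Nat.one_le_iff_ne_zero.2 ((hT.mem_iff_ne_zero c).1 h1.1), h1.2⟩
    · intro k hk
      obtain ⟨c, hc, rfl⟩ := hT.1.surjOn (show k ∈ Set.Icc 1 ν.card from ⟨hk.1, by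
        have := hk.2; omega⟩)
      exact ⟨c, Finset.mem_coe.2 ((mem_cells c).2 ((hmem c).2
        ⟨(mem_cells c).1 (Finset.mem_coe.1 hc), hk.2⟩)), rfl⟩
  have hcard : μ.card = n := by
    have h1 := Set.ncard_congr' (hbij.equiv T)
    rw [Set.ncard_coe_finset, ← Finset.coe_Icc, Set.ncard_coe_finset, Nat.card_Icc] at h1
    exact h1
  let T' : ℕ × ℕ → ℕ := fun c => if c ∈ μ then T c else 0
  have hin : ∀ c ∈ μ, T' c = T c := fun c hc => if_pos hc
  refine ⟨μ, hcard, hle, T', ⟨?_, ?_, ?_, fun c hc => if_neg hc⟩, ?_⟩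
  · rw [hcard]
    exact hbij.congr fun c hc => (hin c ((mem_cells c).1 (Finset.mem_coe.1 hc))).symm
  · intro i j1 j2 hj hm
    rw [hin _ hm, hin _ (μ.up_left_mem le_rfl hj.le hm)]
    exact hT.2.1 i j1 j2 hj (hle hm)
  · intro i1 i2 j hi hm
    rw [hin _ hm, hin _ (μ.up_left_mem hi.le le_rfl hm)]
    exact hT.2.2.1 i1 i2 j hi (hle hm)
  · funext c
    by_cases h1 : c ∈ μ
    · rw [extendTableau, if_pos h1, hin c h1]
    · rw [extendTableau, if_neg h1]
      split_ifs with h2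
      · have h3 : ¬ T c ≤ n := fun h => h1 ((hmem c).2 ⟨h2, h⟩)
        have := hT.apply_le_card c
        omega
      · exact (hT.2.2.2 c h2).symm

open scoped Classical in
/-- The branching rule for the number of standard Young tableaux. -/
theorem sytCard_eq_sum {n : ℕ} {ν : YoungDiagram} (hν : ν.card = n + 1) :
    sytCard ν = ∑ μ ∈ (ofCard n).filter (· ≤ ν), sytCard μ := by
  simp_rw [← card_sytFinset]
  rw [← Finset.card_sigma]
  symm
  refine Finset.card_bij (fun p _ => extendTableau ν p.1 p.2) ?_ ?_ ?_
  · rintro ⟨μ, T⟩ hp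
    simp only [Finset.mem_sigma, Finset.mem_filter, mem_ofCard, mem_sytFinset] at hp ⊢
    exact hp.2.extend hp.1.2 (by omega)
  · rintro ⟨μ, T⟩ hp ⟨μ', T'⟩ hp' heq
    simp only [Finset.mem_sigma, Finset.mem_filter, mem_ofCard, mem_sytFinset] at hp hp' heq
    have hμ : μ = μ' := by
      refine SetLike.ext fun c => ?_
      rw [hp.2.mem_iff_extend_lt hp.1.2 (by omega), heq,
        ← hp'.2.mem_iff_extend_lt hp'.1.2 (by omega)]
    subst hμ
    congr 1
    funext c
    by_cases hc : c ∈ μ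
    · simpa [extendTableau, hc] using congrFun heq c
    · rw [hp.2.2.2.2 c hc, hp'.2.2.2.2 c hc]
  · intro T hT
    obtain ⟨μ, h1, h2, T', h3, h4⟩ := (mem_sytFinset.1 hT).exists_eq_extend hν
    exact ⟨⟨μ, T'⟩, by simp [h1, h2, h3], h4⟩

open scoped Classical in
theorem sum_filter_sum_filter_eq_sum_card_mul {α β : Type*} (s : Finset α) (t : Finset β)
    (p : α → Prop) (r : α → β → Prop) (f : β → ℕ) :
    ∑ a ∈ s.filter p, ∑ b ∈ t.filter (r a), f b =
      ∑ b ∈ t, (s.filter fun a => p a ∧ r a b).card * f b := by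
  simp_rw [Finset.sum_filter (r _)]
  rw [Finset.sum_comm]
  refine Finset.sum_congr rfl fun b _ => ?_
  rw [← Finset.sum_filter, Finset.filter_filter, Finset.sum_const, smul_eq_mul]

theorem YoungDiagram.ofCard_zero : ofCard 0 = {⊥} := by
  ext μ
  rw [mem_ofCard, Finset.mem_singleton, YoungDiagram.card, Finset.card_eq_zero, ← cells_bot]
  exact ⟨YoungDiagram.ext, fun h => h ▸ rfl⟩

open scoped Classical in
/-- The dual branching rule for the number of standard Young tableaux. -/
theorem sum_sytCard_filter_le (n : ℕ) {μ : YoungDiagram} (hμ : μ.card = n) :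
    ∑ ν ∈ (ofCard (n + 1)).filter (μ ≤ ·), sytCard ν = (n + 1) * sytCard μ := by
  have hbranch : ∑ ν ∈ (ofCard (n + 1)).filter (μ ≤ ·), sytCard ν =
      ∑ ν ∈ (ofCard (n + 1)).filter (μ ≤ ·), ∑ κ ∈ (ofCard n).filter (· ≤ ν), sytCard κ :=
    Finset.sum_congr rfl fun ν hν => sytCard_eq_sum (mem_ofCard.1 (Finset.mem_filter.1 hν).1)
  rw [hbranch, sum_filter_sum_filter_eq_sum_card_mul]
  induction n generalizing μ with
  | zero =>
    obtain rfl : μ = ⊥ := by simpa [ofCard_zero] using mem_ofCard.2 hμ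
    rw [ofCard_zero, Finset.sum_singleton]
    simp only [and_self]
    rw [card_filter_le_eq_card_rows hμ]
    simp [Finset.filter_singleton]
  | succ n ih =>
    have hstep : ∀ κ ∈ ofCard (n + 1),
        ((ofCard (n + 2)).filter fun ν => μ ≤ ν ∧ κ ≤ ν).card * sytCard κ =
        ((ofCard n).filter fun ν => ν ≤ μ ∧ ν ≤ κ).card * sytCard κ +
          if κ = μ then sytCard κ else 0 := by
      intro κ hκ
      split_ifs with h
      · subst h
        simp only [and_self]
        rw [card_filter_le_eq_card_filter_ge_add_one hμ, add_mul, one_mul]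
      · rw [card_filter_le_le_eq_card_filter_ge_ge hμ (mem_ofCard.1 hκ) h, add_zero]
    rw [Finset.sum_congr rfl hstep, Finset.sum_add_distrib, Finset.sum_ite_eq',
      if_pos (mem_ofCard.2 hμ), ← sum_filter_sum_filter_eq_sum_card_mul]
    have hdown : ∀ ν ∈ (ofCard n).filter (· ≤ μ),
        ∑ κ ∈ (ofCard (n + 1)).filter (ν ≤ ·), sytCard κ = (n + 1) * sytCard ν := by
      intro ν hν
      have hν' := mem_ofCard.1 (Finset.mem_filter.1 hν).1
      rw [← ih hν' (Finset.sum_congr rfl fun κ hκ =>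
        sytCard_eq_sum (mem_ofCard.1 (Finset.mem_filter.1 hκ).1)),
        ← sum_filter_sum_filter_eq_sum_card_mul]
      exact Finset.sum_congr rfl fun κ hκ =>
        sytCard_eq_sum (mem_ofCard.1 (Finset.mem_filter.1 hκ).1)
    rw [Finset.sum_congr rfl hdown, ← Finset.mul_sum, ← sytCard_eq_sum hμ]
    ring

/-- The sum of the squares of the numbers of standard Young tableaux with `n` entries is `n!`. -/
theorem sum_sytCard_sq (n : ℕ) : ∑ μ ∈ ofCard n, sytCard μ ^ 2 = n.factorial := by
  classical
  induction n with
  | zero =>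
    have h : sytFinset ⊥ = {0} := by
      ext T
      rw [mem_sytFinset, Finset.mem_singleton]
      constructor
      · intro hT
        funext c
        exact hT.2.2.2 c (notMem_bot c)
      · rintro rfl
        refine ⟨?_, fun _ _ _ _ h => absurd h (notMem_bot _),
          fun _ _ _ _ h => absurd h (notMem_bot _), fun _ _ => rfl⟩
        simp [YoungDiagram.card]
    rw [ofCard_zero, Finset.sum_singleton, ← card_sytFinset, h]
    rfl
  | succ n ih =>
    have h1 : ∀ ν ∈ ofCard (n + 1), sytCard ν ^ 2 =
        ∑ μ ∈ ofCard n, if μ ≤ ν then sytCard μ * sytCard ν else 0 := by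
      intro ν hν
      rw [← Finset.sum_filter, ← Finset.sum_mul, ← sytCard_eq_sum (mem_ofCard.1 hν), sq]
    rw [Finset.sum_congr rfl h1, Finset.sum_comm, Nat.factorial_succ, ← ih, Finset.mul_sum]
    refine Finset.sum_congr rfl fun μ hμ => ?_
    rw [← Finset.sum_filter, ← Finset.mul_sum, sum_sytCard_filter_le n (mem_ofCard.1 hμ)]
    ring

/-- Pairs of tableaux of the same shape with `n` cells, grouped by their shape. -/
def sameShapePairsEquiv (n : ℕ) :
    {PQ : (Σ l : YoungDiagram, {T : ℕ × ℕ → ℕ // IsSYT l T}) ×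
        (Σ l : YoungDiagram, {T : ℕ × ℕ → ℕ // IsSYT l T}) //
      PQ.1.1 = PQ.2.1 ∧ PQ.1.1.card = n} ≃
    Σ l : {l : YoungDiagram // l ∈ ofCard n},
      {T : ℕ × ℕ → ℕ // IsSYT l T} × {T : ℕ × ℕ → ℕ // IsSYT l T} where
  toFun x := ⟨⟨x.1.1.1, mem_ofCard.2 x.2.2⟩, x.1.1.2, ⟨x.1.2.2.1,
    (congrArg (IsSYT · x.1.2.2.1) x.2.1).mpr x.1.2.2.2⟩⟩
  invFun y := ⟨(⟨y.1, y.2.1⟩, ⟨y.1, y.2.2⟩), rfl, mem_ofCard.1 y.1.2⟩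
  left_inv := by
    rintro ⟨⟨⟨l, P⟩, ⟨l', Q⟩⟩, h, h'⟩
    obtain rfl : l = l' := h
    rfl
  right_inv := fun _ => rfl

/-- Robinson–Schensted correspondence: for every positive
`n` there is a bijection between the symmetric group `S_n` and pairs `(P, Q)`
of standard Young tableaux with `n` entries of the same shape. -/
theorem rsk_correspondence_exists (n : ℕ) (hn : 0 < n) :
    Nonempty
      (Equiv.Perm (Fin n) ≃
        {PQ : (Σ l : YoungDiagram, {T : ℕ × ℕ → ℕ // IsSYT l T}) ×
              (Σ l : YoungDiagram, {T : ℕ × ℕ → ℕ // IsSYT l T}) //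
          PQ.1.1 = PQ.2.1 ∧ PQ.1.1.card = n}) := by
  have hsyt : ∀ l : YoungDiagram, Finite {T : ℕ × ℕ → ℕ // IsSYT l T} := finite_setOf_isSYT
  have hfin := Finite.of_equiv _ (sameShapePairsEquiv n).symm
  rw [← Finite.card_eq, Nat.card_congr (sameShapePairsEquiv n), Nat.card_sigma, Nat.card_perm,
    Nat.card_fin, ← sum_sytCard_sq, ← Finset.sum_coe_sort]
  exact Finset.sum_congr rfl fun l _ => by rw [Nat.card_prod, sq]; rfl
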